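/- arXiv:1508.02267 — 3 statements merged into one kernel-verified Lean document; each statement's English description precedes it below -/
import Mathlib

section
/- Let Ψ be an infinite set and k a field. For d ∈ ℤ let V_d ⊆ k(Ψ) be the set consisting of 0 together with all quotients p/q of nonzero homogeneous polynomials p, q in the variables Ψ over k with deg p − deg q = d. Then every smooth irreducible k-linear representation W of S_Ψ admits an injective k-linear S_Ψ-equivariant map W → V_d for some d ∈ ℤ. -/
/-- The image of the variable `X i` in `k(Ψ)`. -/
noncomputable def ratX (k : Type) [Field k] {Ψ : Type} (i : Ψ) :
    FractionRing (MvPolynomial Ψ k) :=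
  algebraMap (MvPolynomial Ψ k) (FractionRing (MvPolynomial Ψ k)) (MvPolynomial.X i)

/-- The image of the constant `c : k` in `k(Ψ)`. -/
noncomputable def ratC (k : Type) [Field k] {Ψ : Type} (c : k) :
    FractionRing (MvPolynomial Ψ k) :=
  algebraMap (MvPolynomial Ψ k) (FractionRing (MvPolynomial Ψ k)) (MvPolynomial.C c)

/-- `V_d ⊆ k(Ψ)`: the set consisting of `0` together with all quotients `p/q` of
nonzero homogeneous polynomials `p, q` with `deg p - deg q = d`. -/
noncomputable def homFrac (k : Type) [Field k] (Ψ : Type) (d : ℤ) :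
    Set (FractionRing (MvPolynomial Ψ k)) :=
  {x | x = 0 ∨ ∃ (p q : MvPolynomial Ψ k) (a b : ℕ),
    p ≠ 0 ∧ q ≠ 0 ∧ p.IsHomogeneous a ∧ q.IsHomogeneous b ∧ (a : ℤ) - (b : ℤ) = d ∧
    x = algebraMap (MvPolynomial Ψ k) (FractionRing (MvPolynomial Ψ k)) p /
        algebraMap (MvPolynomial Ψ k) (FractionRing (MvPolynomial Ψ k)) q}

section PermRep

variable {k Ψ W : Type*} [Field k] [AddCommGroup W] [Module k W]
  (ρ : Equiv.Perm Ψ →* (W ≃ₗ[k] W))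

/-- The vectors fixed by the pointwise stabilizer of some finite subset of `Ψ` that misses `t`. -/
def vectorsAvoiding (t : Ψ) : Submodule k W where
  carrier := {w | ∃ S : Finset Ψ, t ∉ S ∧ ∀ g : Equiv.Perm Ψ, (∀ s ∈ S, g s = s) → ρ g w = w}
  zero_mem' := ⟨∅, by simp, by simp⟩
  add_mem' := by
    classical
    rintro v w ⟨S, htS, hS⟩ ⟨S', htS', hS'⟩
    refine ⟨S ∪ S', by simp [htS, htS'], fun g hg ↦ ?_⟩
    rw [map_add, hS g fun s hs ↦ hg s (by simp [hs]), hS' g fun s hs ↦ hg s (by simp [hs])]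
  smul_mem' := by
    rintro c w ⟨S, htS, hS⟩
    exact ⟨S, htS, fun g hg ↦ by rw [map_smul, hS g hg]⟩

/-- The span of the vectors with a finite support that does not contain `T`. -/
def vectorsNotSupporting (T : Finset Ψ) : Submodule k W :=
  ⨆ t ∈ T, vectorsAvoiding ρ t

variable {ρ}

theorem vectorsAvoiding_le_vectorsNotSupporting {T : Finset Ψ} {t : Ψ} (ht : t ∈ T) :
    vectorsAvoiding ρ t ≤ vectorsNotSupporting ρ T :=
  le_biSup (vectorsAvoiding ρ) ht

theorem apply_fixed_by_image {w : W} {S : Finset Ψ}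
    (hS : ∀ g : Equiv.Perm Ψ, (∀ s ∈ S, g s = s) → ρ g w = w) (h g : Equiv.Perm Ψ)
    (hg : ∀ s ∈ S, g (h s) = h s) : ρ g (ρ h w) = ρ h w := by
  have := hS (h⁻¹ * g * h) fun s hs ↦ by simp [hg s hs]
  calc ρ g (ρ h w) = ρ h (ρ (h⁻¹ * g * h) w) := by
        rw [← LinearEquiv.mul_apply, ← LinearEquiv.mul_apply, ← map_mul, ← map_mul]
        congr 2
        group
    _ = ρ h w := by rw [this]

theorem apply_mem_vectorsNotSupporting_of_not_subset {w : W} {S T : Finset Ψ}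
    (hS : ∀ g : Equiv.Perm Ψ, (∀ s ∈ S, g s = s) → ρ g w = w) (h : Equiv.Perm Ψ)
    {t : Ψ} (ht : t ∈ T) (htS : h⁻¹ t ∉ S) : ρ h w ∈ vectorsNotSupporting ρ T := by
  refine vectorsAvoiding_le_vectorsNotSupporting ht
    ⟨S.map h.toEmbedding, fun hmem ↦ ?_, fun g hg ↦ ?_⟩
  · obtain ⟨s, hs, rfl⟩ := Finset.mem_map.1 hmem
    exact htS (by simpa using hs)
  · exact apply_fixed_by_image hS h g fun s hs ↦ hg _ (Finset.mem_map_of_mem _ hs)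

theorem apply_mem_vectorsNotSupporting {T : Finset Ψ} {g : Equiv.Perm Ψ}
    (hg : ∀ t ∈ T, g t = t) {w : W} (hw : w ∈ vectorsNotSupporting ρ T) :
    ρ g w ∈ vectorsNotSupporting ρ T := by
  suffices vectorsNotSupporting ρ T ≤ (vectorsNotSupporting ρ T).comap (ρ g).toLinearMap from
    this hw
  refine iSup₂_le fun t ht v hv ↦ ?_
  obtain ⟨S, htS, hS⟩ := hv
  refine apply_mem_vectorsNotSupporting_of_not_subset hS g ht ?_
  rwa [Equiv.Perm.inv_eq_iff_eq.2 (hg t ht).symm]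

/-- If `vectorsNotSupporting ρ T` becomes everything as soon as `T` is enlarged, then the
transpositions away from `T` act trivially on the quotient by it. -/
theorem swap_apply_sub_mem [Infinite Ψ] [DecidableEq Ψ] {T : Finset Ψ}
    (hT : ∀ t ∉ T, vectorsNotSupporting ρ (insert t T) = ⊤)
    {s t : Ψ} (hs : s ∉ T) (ht : t ∉ T) (w : W) :
    ρ (Equiv.swap s t) w - w ∈ vectorsNotSupporting ρ T := by
  have fixes : ∀ a ∉ T, ∀ b ∉ T, ∀ x ∈ T, Equiv.swap a b x = x := fun a ha b hb x hx ↦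
    Equiv.swap_apply_of_ne_of_ne (fun h ↦ ha (h ▸ hx)) (fun h ↦ hb (h ▸ hx))
  have key : ∀ a ∉ T, ∃ S : Finset Ψ, ∀ b ∉ S, b ∉ T → ∀ v : W,
      v - w ∈ vectorsNotSupporting ρ T → ρ (Equiv.swap a b) v - w ∈ vectorsNotSupporting ρ T := by
    intro a ha
    have hw : w ∈ vectorsAvoiding ρ a ⊔ vectorsNotSupporting ρ T := by
      have : w ∈ vectorsNotSupporting ρ (insert a T) := by rw [hT a ha]; trivial
      rwa [vectorsNotSupporting, Finset.iSup_insert] at this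
    obtain ⟨u, ⟨S, haS, hS⟩, n, hn, rfl⟩ := Submodule.mem_sup.1 hw
    refine ⟨S, fun b hbS hbT v hv ↦ ?_⟩
    have hu : ρ (Equiv.swap a b) u = u := hS _ fun x hx ↦
      Equiv.swap_apply_of_ne_of_ne (fun h ↦ haS (h ▸ hx)) (fun h ↦ hbS (h ▸ hx))
    have hstab {x : W} (hx : x ∈ vectorsNotSupporting ρ T) :=
      apply_mem_vectorsNotSupporting (fixes a ha b hbT) hx
    have := add_mem (hstab hv) (sub_mem (hstab hn) hn)
    convert this using 1
    simp only [map_sub, map_add, hu]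
    abel
  obtain rfl | hst := eq_or_ne s t
  · rw [Equiv.swap_self, ← Equiv.Perm.one_def, map_one, LinearEquiv.coe_one, id, sub_self]
    exact zero_mem _
  obtain ⟨S, hS⟩ := key s hs
  obtain ⟨S', hS'⟩ := key t ht
  obtain ⟨u, hu⟩ := Infinite.exists_notMem_finset (S ∪ S' ∪ T ∪ {s, t})
  simp only [Finset.mem_union, Finset.mem_insert, Finset.mem_singleton, not_or] at hu
  obtain ⟨⟨⟨huS, huS'⟩, huT⟩, hus, hut⟩ := hu
  have h := hS u huS huT _ <| hS' u huS' huT _ <| hS u huS huT w (by simp)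
  have hmul : Equiv.swap s t = Equiv.swap s u * Equiv.swap t u * Equiv.swap s u := by
    rw [Equiv.swap_comm s u, Equiv.swap_mul_swap_mul_swap (Ne.symm hut) hst.symm]
  simpa [hmul] using h

/-- If `vectorsNotSupporting ρ T` becomes everything as soon as `T` is enlarged, then the
pointwise stabilizer of `T` acts trivially on the quotient by it. -/
theorem apply_sub_mem_of_fixes [Infinite Ψ] [DecidableEq Ψ] {T : Finset Ψ}
    (hsmooth : ∀ w : W, ∃ S : Finset Ψ, ∀ g : Equiv.Perm Ψ, (∀ s ∈ S, g s = s) → ρ g w = w)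
    (hT : ∀ t ∉ T, vectorsNotSupporting ρ (insert t T) = ⊤)
    {g : Equiv.Perm Ψ} (hg : ∀ t ∈ T, g t = t) (w : W) :
    ρ g w - w ∈ vectorsNotSupporting ρ T := by
  obtain ⟨S, hS⟩ := hsmooth w
  suffices ∀ A : Finset Ψ,
      (∀ g : Equiv.Perm Ψ, (∀ t ∈ A ∪ T, g t = t) → ρ g w - w ∈ vectorsNotSupporting ρ T) →
      ∀ g : Equiv.Perm Ψ, (∀ t ∈ T, g t = t) → ρ g w - w ∈ vectorsNotSupporting ρ T from
    this S (fun g hg ↦ by simp [hS g fun s hs ↦ hg s (by simp [hs])]) g hg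
  intro A
  induction A using Finset.induction_on with
  | empty => simp
  | insert a A _ ih =>
    intro hA
    refine ih fun g hg ↦ ?_
    by_cases haA : a ∈ A ∪ T
    · exact hA g fun t ht ↦ hg t (by aesop)
    have hne : ∀ t ∈ A ∪ T, t ≠ a ∧ t ≠ g a := fun t ht ↦
      ⟨fun h ↦ haA (h ▸ ht), fun h ↦ haA <| by rwa [← g.injective ((hg t ht).trans h)]⟩
    have haT : a ∉ T := fun h ↦ haA (by simp [h])
    have hgaT : g a ∉ T := fun h ↦ (hne (g a) (by simp [h])).2 rfl
    have hswap : ∀ t ∈ A ∪ T, Equiv.swap a (g a) t = t := fun t ht ↦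
      Equiv.swap_apply_of_ne_of_ne (hne t ht).1 (hne t ht).2
    have h := hA (Equiv.swap a (g a) * g) fun t ht ↦ by
      rw [Finset.insert_union, Finset.mem_insert] at ht
      obtain rfl | ht := ht
      · simp
      · rw [Equiv.Perm.mul_apply, hg t ht, hswap t ht]
    have h' := apply_mem_vectorsNotSupporting
      (fun t ht ↦ hswap t (Finset.mem_union_right _ ht)) h
    have h'' := add_mem h' (swap_apply_sub_mem hT haT hgaT w)
    rwa [map_sub, ← LinearEquiv.mul_apply, ← map_mul, ← mul_assoc, Equiv.swap_mul_self, one_mul,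
      sub_add_sub_cancel] at h''

/-- In a smooth irreducible representation there is a nonzero functional invariant under the
pointwise stabilizer of a finite set `T` and vanishing on all vectors with a finite support that
does not contain `T`. -/
theorem exists_functional [Infinite Ψ]
    (hsmooth : ∀ w : W, ∃ S : Finset Ψ, ∀ g : Equiv.Perm Ψ, (∀ s ∈ S, g s = s) → ρ g w = w)
    (hnonzero : ∃ w : W, w ≠ 0)
    (hirred : ∀ p : Submodule k W,
      (∀ g : Equiv.Perm Ψ, ∀ w ∈ p, ρ g w ∈ p) → p = ⊥ ∨ p = ⊤) :
    ∃ (T : Finset Ψ) (l : W →ₗ[k] k), l ≠ 0 ∧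
      (∀ g : Equiv.Perm Ψ, (∀ t ∈ T, g t = t) → ∀ w, l (ρ g w) = l w) ∧
      ∀ w ∈ vectorsNotSupporting ρ T, l w = 0 := by
  classical
  obtain ⟨w, hw⟩ := hnonzero
  obtain ⟨S, hS⟩ := hsmooth w
  have hspan : Submodule.span k (Set.range fun g ↦ ρ g w) = ⊤ := by
    refine (hirred _ fun g v hv ↦ ?_).resolve_left fun h ↦ hw ?_
    · suffices Submodule.span k (Set.range fun g ↦ ρ g w) ≤
          (Submodule.span k (Set.range fun g ↦ ρ g w)).comap (ρ g).toLinearMap from this hv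
      refine Submodule.span_le.2 ?_
      rintro _ ⟨h, rfl⟩
      exact Submodule.subset_span ⟨g * h, by simp⟩
    · rw [← Submodule.mem_bot k, ← h]
      exact Submodule.subset_span ⟨1, by simp⟩
  have hcard : ∀ T : Finset Ψ, vectorsNotSupporting ρ T ≠ ⊤ → T.card ≤ S.card := by
    intro T hT
    by_contra! hlt
    refine hT (top_le_iff.1 (hspan ▸ Submodule.span_le.2 ?_))
    rintro _ ⟨h, rfl⟩
    obtain ⟨t, ht, htS⟩ := Finset.exists_mem_notMem_of_card_lt_card
      (s := S.map h.toEmbedding) (t := T) (by simpa using hlt)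
    exact apply_mem_vectorsNotSupporting_of_not_subset hS h ht fun hmem ↦
      htS (Finset.mem_map.2 ⟨_, hmem, by simp⟩)
  have hempty : vectorsNotSupporting ρ ∅ ≠ ⊤ := fun h ↦ hw <| by
    have : w ∈ vectorsNotSupporting ρ ∅ := h ▸ Submodule.mem_top
    simpa [vectorsNotSupporting] using this
  obtain ⟨T, hT, hmax⟩ : ∃ T : Finset Ψ, vectorsNotSupporting ρ T ≠ ⊤ ∧
      ∀ t ∉ T, vectorsNotSupporting ρ (insert t T) = ⊤ := by
    by_contra! hne
    have : ∀ n : ℕ, ∃ T : Finset Ψ, T.card = n ∧ vectorsNotSupporting ρ T ≠ ⊤ := by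
      intro n
      induction n with
      | zero => exact ⟨∅, rfl, hempty⟩
      | succ n ih =>
        obtain ⟨T, hTn, hT⟩ := ih
        obtain ⟨t, ht, hT'⟩ := hne T hT
        exact ⟨insert t T, by rw [Finset.card_insert_of_notMem ht, hTn], hT'⟩
    obtain ⟨T, hTn, hT⟩ := this (S.card + 1)
    have := hcard T hT
    omega
  obtain ⟨l, hl0, hl⟩ := Submodule.exists_le_ker_of_lt_top _ (lt_top_iff_ne_top.2 hT)
  refine ⟨T, l, hl0, fun g hg v ↦ ?_, fun v hv ↦ hl hv⟩
  have := hl (apply_sub_mem_of_fixes hsmooth hmax hg v)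
  rwa [LinearMap.mem_ker, map_sub, sub_eq_zero] at this

end PermRep

/-- Every finite set is the support of an exponent vector with distinct nonzero entries. -/
theorem exists_exponent_injOn_support {Ψ : Type*} (T : Finset Ψ) :
    ∃ m : Ψ →₀ ℕ, m.support = T ∧ Set.InjOn m T := by
  classical
  refine ⟨Finsupp.indicator T fun t ht ↦ T.equivFin ⟨t, ht⟩ + 1, ?_, fun s hs t ht h ↦ ?_⟩
  · ext t
    by_cases ht : t ∈ T <;> simp [Finsupp.indicator_apply, ht]
  · rw [Finsupp.indicator_of_mem hs, Finsupp.indicator_of_mem ht, Nat.succ_inj] at h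
    simpa using T.equivFin.injective (Fin.ext h)

/-- A linear family of finitely supported coefficient functions comes from a linear map to
polynomials. -/
theorem MvPolynomial.exists_linearMap_coeff_eq {σ k W : Type*} [Field k] [AddCommGroup W]
    [Module k W] (c : W →ₗ[k] (σ →₀ ℕ) → k) (hc : ∀ w, (Function.support (c w)).Finite) :
    ∃ F : W →ₗ[k] MvPolynomial σ k, ∀ w m, (F w).coeff m = c w m := by
  have (w : W) : ∃ p : MvPolynomial σ k, ∀ m, p.coeff m = c w m :=
    ⟨AddMonoidAlgebra.ofCoeff (Finsupp.ofSupportFinite (c w) (hc w)), fun _ ↦ rfl⟩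
  choose F hF using this
  refine ⟨{ toFun := F, map_add' := fun v w ↦ ?_, map_smul' := fun a w ↦ ?_ }, hF⟩
  · ext m
    simp [hF]
  · ext m
    simp [hF]

theorem act_algebraMap {k Ψ : Type} [Field k]
    (act : Equiv.Perm Ψ →*
      (FractionRing (MvPolynomial Ψ k) ≃+* FractionRing (MvPolynomial Ψ k)))
    (hactX : ∀ (g : Equiv.Perm Ψ) (i : Ψ), act g (ratX k i) = ratX k (g i))
    (hactC : ∀ (g : Equiv.Perm Ψ) (c : k), act g (ratC k c) = ratC k c)
    (g : Equiv.Perm Ψ) (p : MvPolynomial Ψ k) :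
    act g (algebraMap _ _ p) = algebraMap _ _ (MvPolynomial.rename g p) := by
  induction p using MvPolynomial.induction_on with
  | C a => simpa [ratC] using hactC g a
  | add p q hp hq => simp only [map_add, hp, hq]
  | mul_X p i hp =>
    have := hactX g i
    rw [ratX, ratX] at this
    simp only [map_mul, hp, this, MvPolynomial.rename_X]

/-- A smooth irreducible representation of the symmetric group embeds equivariantly into the
homogeneous polynomials of some degree. -/
theorem exists_equivariant_linearMap_mvPolynomial {k Ψ W : Type*} [Field k] [Infinite Ψ]
    [AddCommGroup W] [Module k W] (ρ : Equiv.Perm Ψ →* (W ≃ₗ[k] W))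
    (hsmooth : ∀ w : W, ∃ S : Finset Ψ, ∀ g : Equiv.Perm Ψ, (∀ s ∈ S, g s = s) → ρ g w = w)
    (hnonzero : ∃ w : W, w ≠ 0)
    (hirred : ∀ p : Submodule k W,
      (∀ g : Equiv.Perm Ψ, ∀ w ∈ p, ρ g w ∈ p) → p = ⊥ ∨ p = ⊤) :
    ∃ (d : ℕ) (F : W →ₗ[k] MvPolynomial Ψ k), Function.Injective F ∧
      (∀ w, (F w).IsHomogeneous d) ∧
      ∀ (g : Equiv.Perm Ψ) (w : W), F (ρ g w) = MvPolynomial.rename g (F w) := by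
  classical
  obtain ⟨T, l, hl0, hlinv, hlvan⟩ := exists_functional hsmooth hnonzero hirred
  obtain ⟨m₀, hm₀, hinj⟩ := exists_exponent_injOn_support T
  let c : W →ₗ[k] (Ψ →₀ ℕ) → k := LinearMap.pi fun m ↦
    if h : ∃ g : Equiv.Perm Ψ, m₀.mapDomain g = m then l ∘ₗ (ρ h.choose⁻¹).toLinearMap else 0
  have c_mapDomain (w : W) (g : Equiv.Perm Ψ) : c w (m₀.mapDomain g) = l (ρ g⁻¹ w) := by
    have h : ∃ h : Equiv.Perm Ψ, m₀.mapDomain h = m₀.mapDomain g := ⟨g, rfl⟩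
    have hc : c w (m₀.mapDomain g) = l (ρ h.choose⁻¹ w) := by
      simp only [c, LinearMap.pi_apply, dif_pos h]
      rfl
    have hspec := h.choose_spec
    generalize h.choose = a at hc hspec
    have hfix : ∀ t ∈ T, (g⁻¹ * a) t = t := by
      intro t ht
      have hval : m₀ ((g⁻¹ * a) t) = m₀ t := by
        have := DFunLike.congr_fun hspec (a t)
        rw [Finsupp.mapDomain_equiv_apply, Finsupp.mapDomain_equiv_apply,
          Equiv.symm_apply_apply] at this
        exact this.symm
      have hmem : (g⁻¹ * a) t ∈ T := by
        rw [← hm₀, Finsupp.mem_support_iff, hval, ← Finsupp.mem_support_iff, hm₀]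
        exact ht
      exact hinj hmem ht hval
    rw [hc, ← hlinv _ hfix, ← LinearEquiv.mul_apply, ← map_mul, mul_assoc, mul_inv_cancel, mul_one]
  have c_eq_zero (w : W) (m : Ψ →₀ ℕ) (hm : ¬ ∃ g : Equiv.Perm Ψ, m₀.mapDomain g = m) :
      c w m = 0 := by
    simp only [c, LinearMap.pi_apply, dif_neg hm, LinearMap.zero_apply]
  have exists_of_ne {w : W} {m : Ψ →₀ ℕ} (hm : c w m ≠ 0) :
      ∃ g : Equiv.Perm Ψ, m₀.mapDomain g = m := by
    by_contra h
    exact hm (c_eq_zero w m h)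
  have c_finite (w : W) : (Function.support (c w)).Finite := by
    obtain ⟨S, hS⟩ := hsmooth w
    refine (Finset.finite_toSet (S.finsupp fun _ ↦ T.image m₀ ∪ {0})).subset fun m hm ↦ ?_
    obtain ⟨g, rfl⟩ := exists_of_ne hm
    rw [Function.mem_support, c_mapDomain] at hm
    have hgT : ∀ t ∈ T, g t ∈ S := by
      intro t ht
      by_contra hgt
      exact hm (hlvan _ (apply_mem_vectorsNotSupporting_of_not_subset hS g⁻¹ ht (by simpa)))
    rw [Finset.mem_coe, Finset.mem_finsupp_iff]
    refine ⟨fun x hx ↦ ?_, fun x _ ↦ ?_⟩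
    · rw [Finsupp.mem_support_iff, Finsupp.mapDomain_equiv_apply, ← Finsupp.mem_support_iff,
        hm₀] at hx
      simpa using hgT _ hx
    · rw [Finsupp.mapDomain_equiv_apply]
      by_cases hx : g.symm x ∈ T
      · exact Finset.mem_union_left _ (Finset.mem_image_of_mem _ hx)
      · rw [← hm₀, Finsupp.notMem_support_iff] at hx
        simp [hx]
  obtain ⟨F, hF⟩ := MvPolynomial.exists_linearMap_coeff_eq c c_finite
  have hequiv (g : Equiv.Perm Ψ) (w : W) : F (ρ g w) = MvPolynomial.rename g (F w) := by
    ext m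
    obtain ⟨m, rfl⟩ : ∃ m' : Ψ →₀ ℕ, m'.mapDomain g = m :=
      ⟨m.mapDomain g.symm, by rw [← Finsupp.mapDomain_comp]; simp⟩
    rw [MvPolynomial.coeff_rename_mapDomain _ g.injective, hF, hF]
    by_cases hm : ∃ h : Equiv.Perm Ψ, m₀.mapDomain h = m
    · obtain ⟨h, rfl⟩ := hm
      rw [← Finsupp.mapDomain_comp, ← Equiv.Perm.coe_mul, c_mapDomain, c_mapDomain,
        ← LinearEquiv.mul_apply, ← map_mul]
      simp
    · rw [c_eq_zero w m hm, c_eq_zero]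
      rintro ⟨h, hh⟩
      refine hm ⟨g⁻¹ * h, Finsupp.mapDomain_injective g.injective ?_⟩
      rw [← Finsupp.mapDomain_comp, ← Equiv.Perm.coe_mul, mul_inv_cancel_left, hh]
  refine ⟨m₀.degree, F, LinearMap.ker_eq_bot.1 ?_, fun w m hm ↦ ?_, hequiv⟩
  · refine (hirred _ fun g w hw ↦ ?_).resolve_right fun h ↦ hl0 ?_
    · rw [LinearMap.mem_ker] at hw ⊢
      rw [hequiv, hw, map_zero]
    · ext w
      have hw : F w = 0 := by rw [← LinearMap.mem_ker, h]; trivial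
      have := hF w (m₀.mapDomain (1 : Equiv.Perm Ψ))
      rw [c_mapDomain, hw] at this
      simpa using this.symm
  · rw [hF] at hm
    obtain ⟨g, rfl⟩ := exists_of_ne hm
    rw [Pi.one_def, ← Finsupp.degree_eq_weight_one]
    simp [Finsupp.degree_mapDomain]

/-- **Every smooth irreducible `k`-linear representation of `S_Ψ` embeds into
`V_d` for some `d ∈ ℤ`.**  Here `act` is the natural action of `S_Ψ` on `k(Ψ)`
(pinned down by `hactX`, `hactC`), `W` is a nonzero smooth `k`-linear
representation of `S_Ψ` with no nontrivial `S_Ψ`-stable `k`-subspaces, and the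
conclusion provides `d : ℤ` and an injective `k`-linear `S_Ψ`-equivariant map
`W → k(Ψ)` whose image is contained in `V_d = homFrac k Ψ d`. -/
theorem smooth_irreducible_embeds_in_homogeneous_part
    (k : Type) [Field k] (Ψ : Type) [Infinite Ψ]
    (act : Equiv.Perm Ψ →*
      (FractionRing (MvPolynomial Ψ k) ≃+* FractionRing (MvPolynomial Ψ k)))
    (hactX : ∀ (g : Equiv.Perm Ψ) (i : Ψ), act g (ratX k i) = ratX k (g i))
    (hactC : ∀ (g : Equiv.Perm Ψ) (c : k), act g (ratC k c) = ratC k c)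
    (W : Type) [AddCommGroup W] [Module k W]
    (ρ : Equiv.Perm Ψ →* (W ≃ₗ[k] W))
    (hsmooth : ∀ w : W, ∃ T : Finset Ψ,
      ∀ g : Equiv.Perm Ψ, (∀ t ∈ T, g t = t) → ρ g w = w)
    (hnonzero : ∃ w : W, w ≠ 0)
    (hirred : ∀ p : Submodule k W,
      (∀ g : Equiv.Perm Ψ, ∀ w ∈ p, ρ g w ∈ p) → p = ⊥ ∨ p = ⊤) :
    ∃ (d : ℤ) (f : W →ₗ[k] FractionRing (MvPolynomial Ψ k)),
      Function.Injective f ∧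
      (∀ w : W, f w ∈ homFrac k Ψ d) ∧
      (∀ (g : Equiv.Perm Ψ) (w : W), f (ρ g w) = act g (f w)) := by
  obtain ⟨d, F, hinj, hhom, hequiv⟩ :=
    exists_equivariant_linearMap_mvPolynomial ρ hsmooth hnonzero hirred
  refine ⟨d, (IsScalarTower.toAlgHom k (MvPolynomial Ψ k)
    (FractionRing (MvPolynomial Ψ k))).toLinearMap ∘ₗ F, ?_, fun w ↦ ?_, fun g w ↦ ?_⟩
  · exact (IsFractionRing.injective (MvPolynomial Ψ k) _).comp hinj
  · obtain hw | hw := eq_or_ne (F w) 0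
    · exact Or.inl (by simp [hw])
    · exact Or.inr ⟨F w, 1, d, 0, hw, one_ne_zero, hhom w, MvPolynomial.isHomogeneous_one _ _,
        by simp, by simp⟩
  · simp [hequiv, act_algebraMap act hactX hactC]
end

section
/- Let Ψ be an infinite set, k a field, and K the subfield of k(Ψ) generated over k by the elements u − v for all u, v ∈ Ψ. Fix x ∈ Ψ and let K[x] ⊆ k(Ψ) be the K-linear span of the powers x^n, n ≥ 0; K[x] is an S_Ψ-stable K-subspace of k(Ψ). Then every nonzero S_Ψ-stable K-subspace of K[x] contains K; in particular, K is the unique simple K-semilinear subrepresentation of K[x]. -/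
/-- The subfield `K ⊆ k(Ψ)` generated over `k` by the differences `u - v` of
variables `u, v ∈ Ψ`. -/
noncomputable def diffSubfield (k : Type) [Field k] (Ψ : Type) :
    Subfield (FractionRing (MvPolynomial Ψ k)) :=
  Subfield.closure (Set.range (ratC k (Ψ := Ψ)) ∪
    {y | ∃ u v : Ψ, y = ratX k u - ratX k v})

/-- `K[x] ⊆ k(Ψ)`: the `K`-linear span of the powers of the variable `x`. -/
noncomputable def polySpan (k : Type) [Field k] {Ψ : Type} (x : Ψ) :
    Submodule (diffSubfield k Ψ) (FractionRing (MvPolynomial Ψ k)) :=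
  Submodule.span (diffSubfield k Ψ) {y | ∃ n : ℕ, y = (ratX k x) ^ n}

open MvPolynomial in
/-- Coefficients of a product of two polynomials in disjoint sets of variables. -/
theorem coeff_add_mul_of_disjoint_vars {R σ : Type*} [CommSemiring R] {S T : Finset σ}
    (hST : Disjoint S T) {p q : MvPolynomial σ R} (hp : p.vars ⊆ S) (hq : q.vars ⊆ T)
    {m n : σ →₀ ℕ} (hm : m.support ⊆ S) (hn : n.support ⊆ T) :
    coeff (m + n) (p * q) = coeff m p * coeff n q := by
  classical
  rw [coeff_mul]
  refine Finset.sum_eq_single_of_mem (m, n) (by simp) ?_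
  rintro ⟨m', n'⟩ hmem hne
  rw [Finset.HasAntidiagonal.mem_antidiagonal] at hmem
  by_contra hprod
  have hm' : m'.support ⊆ S := fun i hi => hp <| (mem_vars_iff_mem_support _).2
    ⟨m', mem_support_iff.2 (left_ne_zero_of_mul hprod), hi⟩
  have hn' : n'.support ⊆ T := fun i hi => hq <| (mem_vars_iff_mem_support _).2
    ⟨n', mem_support_iff.2 (right_ne_zero_of_mul hprod), hi⟩
  have key : ∀ i, m' i = m i ∧ n' i = n i := by
    intro i
    have hi : m' i + n' i = m i + n i := DFunLike.congr_fun hmem i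
    by_cases hS : i ∈ S
    · have hT : i ∉ T := Finset.disjoint_left.1 hST hS
      have h₁ := Finsupp.notMem_support_iff.1 fun h => hT (hn h)
      have h₂ := Finsupp.notMem_support_iff.1 fun h => hT (hn' h)
      omega
    · have h₁ := Finsupp.notMem_support_iff.1 fun h => hS (hm h)
      have h₂ := Finsupp.notMem_support_iff.1 fun h => hS (hm' h)
      omega
  exact hne (Prod.ext (Finsupp.ext fun i => (key i).1) (Finsupp.ext fun i => (key i).2))

/-- A finite subset of an infinite type can be moved off itself by a permutation. -/
theorem exists_perm_disjoint_image {α : Type*} [DecidableEq α] [Infinite α] (T : Finset α) :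
    ∃ g : Equiv.Perm α, Disjoint T (T.image g) := by
  obtain ⟨T', hT', hcard⟩ := T.finite_toSet.infinite_compl.exists_subset_card_eq T.card
  let e : T ≃ T' := Finset.equivOfCardEq hcard.symm
  obtain ⟨g, hg⟩ := (Equiv.Perm.isMultiplyPretransitive α T.card).exists_smul_eq
    (T.equivFin.symm.toEmbedding.trans (Function.Embedding.subtype _))
    ((T.equivFin.symm.trans e).toEmbedding.trans (Function.Embedding.subtype _))
  refine ⟨g, Finset.disjoint_right.2 fun y hy => ?_⟩
  obtain ⟨t, ht, rfl⟩ := Finset.mem_image.1 hy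
  have h := DFunLike.congr_fun hg (T.equivFin ⟨t, ht⟩)
  have h' : g t = e ⟨t, ht⟩ := by simpa using h
  rw [h']
  exact hT' (e ⟨t, ht⟩).2

section Action

variable {k : Type} [Field k] {Ψ : Type}

theorem map_algebraMap_eq_rename
    (f : FractionRing (MvPolynomial Ψ k) ≃+* FractionRing (MvPolynomial Ψ k))
    (g : Equiv.Perm Ψ) (hX : ∀ i, f (ratX k i) = ratX k (g i))
    (hC : ∀ c, f (ratC k c) = ratC k c) (p : MvPolynomial Ψ k) :
    f (algebraMap _ _ p) = algebraMap _ _ (MvPolynomial.rename g p) := by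
  have h : f.toRingHom.comp (algebraMap (MvPolynomial Ψ k) _) =
      (algebraMap (MvPolynomial Ψ k) _).comp
        (MvPolynomial.rename g : MvPolynomial Ψ k →ₐ[k] MvPolynomial Ψ k).toRingHom := by
    refine MvPolynomial.ringHom_ext (fun c => ?_) (fun i => ?_)
    · simpa [ratC] using hC c
    · simpa [ratX] using hX i
  exact RingHom.congr_fun h p

/-- A rational function in infinitely many variables fixed by all permutations of the variables
is constant. -/
theorem mem_range_ratC_of_fixed [Infinite Ψ]
    (act : Equiv.Perm Ψ →
      (FractionRing (MvPolynomial Ψ k) ≃+* FractionRing (MvPolynomial Ψ k)))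
    (hactX : ∀ (g : Equiv.Perm Ψ) (i : Ψ), act g (ratX k i) = ratX k (g i))
    (hactC : ∀ (g : Equiv.Perm Ψ) (c : k), act g (ratC k c) = ratC k c)
    (w : FractionRing (MvPolynomial Ψ k)) (hw : ∀ g, act g w = w) :
    ∃ c : k, w = ratC k c := by
  classical
  obtain ⟨a, b, hb, rfl⟩ := IsFractionRing.div_surjective (A := MvPolynomial Ψ k) w
  have hb0 : b ≠ 0 := nonZeroDivisors.ne_zero hb
  have hinj : Function.Injective
      (algebraMap (MvPolynomial Ψ k) (FractionRing (MvPolynomial Ψ k))) :=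
    IsFractionRing.injective _ _
  obtain ⟨g, hg⟩ := exists_perm_disjoint_image (a.vars ∪ b.vars)
  set T := a.vars ∪ b.vars
  set a' := MvPolynomial.rename g a
  set b' := MvPolynomial.rename g b
  have hb'0 : b' ≠ 0 := fun h => hb0 <| MvPolynomial.rename_injective g g.injective
    (h.trans (map_zero _).symm)
  have hcross : a * b' = b * a' := by
    have h := hw g
    rw [map_div₀, map_algebraMap_eq_rename _ g (hactX g) (hactC g),
      map_algebraMap_eq_rename _ g (hactX g) (hactC g),
      div_eq_div_iff ((map_ne_zero_iff _ hinj).2 hb'0) ((map_ne_zero_iff _ hinj).2 hb0),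
      ← map_mul, ← map_mul] at h
    rw [← hinj h, mul_comm]
  have hav : a.vars ⊆ T := Finset.subset_union_left
  have hbv : b.vars ⊆ T := Finset.subset_union_right
  have hav' : a'.vars ⊆ T.image g :=
    (MvPolynomial.vars_rename g a).trans (Finset.image_subset_image hav)
  have hbv' : b'.vars ⊆ T.image g :=
    (MvPolynomial.vars_rename g b).trans (Finset.image_subset_image hbv)
  obtain ⟨n, hn⟩ := MvPolynomial.ne_zero_iff.1 hb'0
  have hnT : n.support ⊆ T.image g := fun i hi =>
    hbv' <| (MvPolynomial.mem_vars_iff_mem_support _).2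
    ⟨n, MvPolynomial.mem_support_iff.2 hn, hi⟩
  have hprop : a = MvPolynomial.C (a'.coeff n / b'.coeff n) * b := by
    ext m
    rw [MvPolynomial.coeff_C_mul]
    by_cases hm : m.support ⊆ T
    · have h := congrArg (MvPolynomial.coeff (m + n)) hcross
      rw [coeff_add_mul_of_disjoint_vars hg hav hbv' hm hnT,
        coeff_add_mul_of_disjoint_vars hg hbv hav' hm hnT] at h
      field_simp
      rw [h, mul_comm]
    · have hzero : ∀ p : MvPolynomial Ψ k, p.vars ⊆ T → p.coeff m = 0 := by
        intro p hp
        by_contra hpm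
        exact hm fun i hi => hp <| (MvPolynomial.mem_vars_iff_mem_support _).2
          ⟨m, MvPolynomial.mem_support_iff.2 hpm, hi⟩
      rw [hzero a hav, hzero b hbv, mul_zero]
  refine ⟨a'.coeff n / b'.coeff n, ?_⟩
  rw [div_eq_iff ((map_ne_zero_iff _ hinj).2 hb0), ratC, ← map_mul, ← hprop]

theorem ratX_sub_ratX_mem_diffSubfield (u v : Ψ) : ratX k u - ratX k v ∈ diffSubfield k Ψ :=
  Subfield.subset_closure (Or.inr ⟨u, v, rfl⟩)

theorem ratC_mem_diffSubfield (c : k) : ratC k c ∈ diffSubfield k Ψ :=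
  Subfield.subset_closure (Or.inl ⟨c, rfl⟩)

theorem map_mem_diffSubfield
    (f : FractionRing (MvPolynomial Ψ k) ≃+* FractionRing (MvPolynomial Ψ k))
    (g : Equiv.Perm Ψ) (hX : ∀ i, f (ratX k i) = ratX k (g i))
    (hC : ∀ c, f (ratC k c) = ratC k c) {y : FractionRing (MvPolynomial Ψ k)}
    (hy : y ∈ diffSubfield k Ψ) : f y ∈ diffSubfield k Ψ := by
  have h : diffSubfield k Ψ ≤ (diffSubfield k Ψ).comap
      f.toRingHom := by
    refine Subfield.closure_le.2 ?_
    rintro _ (⟨c, rfl⟩ | ⟨u, v, rfl⟩)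
    · simpa [hC] using ratC_mem_diffSubfield c
    · simpa [hX] using ratX_sub_ratX_mem_diffSubfield (g u) (g v)
  exact h hy

theorem mem_polySpan_iff (x : Ψ) (v : FractionRing (MvPolynomial Ψ k)) :
    v ∈ polySpan k x ↔
      ∃ P : Polynomial (diffSubfield k Ψ), Polynomial.aeval (ratX k x) P = v := by
  constructor
  · intro hv
    have h : polySpan k x ≤
        LinearMap.range (Polynomial.aeval (R := diffSubfield k Ψ) (ratX k x)).toLinearMap := by
      refine Submodule.span_le.2 ?_
      rintro _ ⟨n, rfl⟩
      exact ⟨Polynomial.X ^ n, by simp⟩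
    exact h hv
  · rintro ⟨P, rfl⟩
    rw [Polynomial.aeval_eq_sum_range]
    exact Submodule.sum_mem _ fun n _ =>
      Submodule.smul_mem _ _ (Submodule.subset_span ⟨n, rfl⟩)

/-- A permutation of the variables carries `P(x)` to `Q(x)` for some polynomial `Q` over
`diffSubfield k Ψ` of the same degree as `P`, which is monic if `P` is. -/
theorem exists_aeval_eq_map_aeval
    (f : FractionRing (MvPolynomial Ψ k) ≃+* FractionRing (MvPolynomial Ψ k))
    (g : Equiv.Perm Ψ) (hX : ∀ i, f (ratX k i) = ratX k (g i))
    (hC : ∀ c, f (ratC k c) = ratC k c) (x : Ψ) (P : Polynomial (diffSubfield k Ψ)) :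
    ∃ Q : Polynomial (diffSubfield k Ψ), Polynomial.aeval (ratX k x) Q =
      f (Polynomial.aeval (ratX k x) P) ∧ Q.degree = P.degree ∧ (P.Monic → Q.Monic) := by
  let φ : diffSubfield k Ψ →+* diffSubfield k Ψ :=
    (f.toRingHom.comp (diffSubfield k Ψ).subtype).codRestrict
      (diffSubfield k Ψ) fun y => map_mem_diffSubfield f g hX hC y.2
  let d : diffSubfield k Ψ := ⟨ratX k (g x) - ratX k x, ratX_sub_ratX_mem_diffSubfield _ _⟩
  refine ⟨(P.map φ).comp (Polynomial.X + Polynomial.C d), ?_, ?_, fun h => ?_⟩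
  · have hd : ratX k x + algebraMap (diffSubfield k Ψ) _ d = f (ratX k x) := by
      rw [hX]
      exact add_sub_cancel _ _
    have hφ : (algebraMap (diffSubfield k Ψ) (FractionRing (MvPolynomial Ψ k))).comp φ =
        f.toRingHom.comp (algebraMap (diffSubfield k Ψ) _) := rfl
    rw [Polynomial.aeval_comp, map_add, Polynomial.aeval_X, Polynomial.aeval_C, hd,
      Polynomial.aeval_def, Polynomial.eval₂_map, hφ, Polynomial.aeval_def]
    exact (Polynomial.hom_eval₂ P _ f.toRingHom _).symm
  · rw [← Polynomial.taylor_apply, Polynomial.degree_taylor, Polynomial.degree_map]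
  · exact (h.map φ).comp_X_add_C d

end Action

/-- **Every nonzero `S_Ψ`-stable `K`-subspace of `K[x]` contains `K`; in
particular `K = K·1` is the unique simple `K`-semilinear subrepresentation of
`K[x]`.**  Here `K = diffSubfield k Ψ` is the subfield of `k(Ψ)` generated over
`k` by differences of variables, `act` is the natural action of `S_Ψ` on `k(Ψ)`
(pinned down by `hactX`, `hactC`), and `x ∈ Ψ`.  The conclusion asserts in
addition that `K[x]` is `S_Ψ`-stable. -/
theorem nonzero_stable_subspace_of_polySpan_contains_K
    (k : Type) [Field k] (Ψ : Type) [Infinite Ψ]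
    (act : Equiv.Perm Ψ →*
      (FractionRing (MvPolynomial Ψ k) ≃+* FractionRing (MvPolynomial Ψ k)))
    (hactX : ∀ (g : Equiv.Perm Ψ) (i : Ψ), act g (ratX k i) = ratX k (g i))
    (hactC : ∀ (g : Equiv.Perm Ψ) (c : k), act g (ratC k c) = ratC k c)
    (x : Ψ) :
    -- `K[x]` is an `S_Ψ`-stable `K`-subspace of `k(Ψ)`
    (∀ g : Equiv.Perm Ψ, ∀ v ∈ polySpan k x, act g v ∈ polySpan k x) ∧
    -- every nonzero `S_Ψ`-stable `K`-subspace of `K[x]` contains `K = K·1`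
    (∀ W : Submodule (diffSubfield k Ψ) (FractionRing (MvPolynomial Ψ k)),
      W ≤ polySpan k x → (∀ g : Equiv.Perm Ψ, ∀ v ∈ W, act g v ∈ W) → W ≠ ⊥ →
      Submodule.span (diffSubfield k Ψ) {(1 : FractionRing (MvPolynomial Ψ k))} ≤ W) ∧
    -- `K` is the unique simple `K`-semilinear subrepresentation of `K[x]`
    (∀ W : Submodule (diffSubfield k Ψ) (FractionRing (MvPolynomial Ψ k)),
      W ≤ polySpan k x → (∀ g : Equiv.Perm Ψ, ∀ v ∈ W, act g v ∈ W) → W ≠ ⊥ →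
      (∀ W' : Submodule (diffSubfield k Ψ) (FractionRing (MvPolynomial Ψ k)),
        W' ≤ W → (∀ g : Equiv.Perm Ψ, ∀ v ∈ W', act g v ∈ W') → W' = ⊥ ∨ W' = W) →
      W = Submodule.span (diffSubfield k Ψ) {(1 : FractionRing (MvPolynomial Ψ k))}) := by
  have hpoly : ∀ g : Equiv.Perm Ψ, ∀ v ∈ polySpan k x, act g v ∈ polySpan k x := by
    intro g v hv
    obtain ⟨P, rfl⟩ := (mem_polySpan_iff x v).1 hv
    obtain ⟨Q, hQ, -⟩ := exists_aeval_eq_map_aeval (act g) g (hactX g) (hactC g) x P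
    exact (mem_polySpan_iff x _).2 ⟨Q, hQ⟩
  have hcontains : ∀ W : Submodule (diffSubfield k Ψ) (FractionRing (MvPolynomial Ψ k)),
      W ≤ polySpan k x → (∀ g : Equiv.Perm Ψ, ∀ v ∈ W, act g v ∈ W) → W ≠ ⊥ →
      Submodule.span (diffSubfield k Ψ) {(1 : FractionRing (MvPolynomial Ψ k))} ≤ W := by
    intro W hW hstable hne
    rw [Submodule.span_singleton_le_iff_mem]
    obtain ⟨w₀, hw₀W, hw₀⟩ := Submodule.exists_mem_ne_zero_of_ne_bot hne
    obtain ⟨P₀, rfl⟩ := (mem_polySpan_iff x w₀).1 (hW hw₀W)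
    let S : Set (Polynomial (diffSubfield k Ψ)) :=
      {P | Polynomial.aeval (ratX k x) P ∈ W ∧ Polynomial.aeval (ratX k x) P ≠ 0}
    obtain ⟨P, ⟨hPW, hP⟩, hmin⟩ : ∃ P ∈ S, ∀ Q ∈ S, ¬ Q.degree < P.degree :=
      (InvImage.wf Polynomial.degree wellFounded_lt).has_min S ⟨P₀, hw₀W, hw₀⟩
    have hP0 : P ≠ 0 := fun h => hP (by rw [h, map_zero])
    -- normalize to a monic polynomial of minimal degree
    set M := Polynomial.C P.leadingCoeff⁻¹ * P with hM
    have hlc : P.leadingCoeff ≠ 0 := Polynomial.leadingCoeff_ne_zero.2 hP0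
    have hMmonic : M.Monic := by
      rw [hM, mul_comm]
      exact Polynomial.monic_mul_leadingCoeff_inv hP0
    have hMdeg : M.degree = P.degree := Polynomial.degree_C_mul (inv_ne_zero hlc)
    have hMval : Polynomial.aeval (ratX k x) M =
        P.leadingCoeff⁻¹ • Polynomial.aeval (ratX k x) P := by
      rw [hM, ← Polynomial.smul_eq_C_mul, map_smul]
    have hMW : Polynomial.aeval (ratX k x) M ∈ W := hMval ▸ W.smul_mem _ hPW
    have hMne : Polynomial.aeval (ratX k x) M ≠ 0 :=
      by
      rw [hMval, Subfield.smul_def, smul_eq_mul]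
      exact mul_ne_zero (fun h => inv_ne_zero hlc (Subtype.ext h)) hP
    obtain ⟨c, hc⟩ := mem_range_ratC_of_fixed act hactX hactC _ fun g => by
      obtain ⟨Q, hQ, hQdeg, hQmonic⟩ :=
        exists_aeval_eq_map_aeval (act g) g (hactX g) (hactC g) x M
      by_contra hfix
      refine hmin (Q - M) ⟨?_, ?_⟩ ?_
      · rw [map_sub, hQ]
        exact W.sub_mem (hstable g _ hMW) hMW
      · rw [map_sub, hQ]
        exact sub_ne_zero.2 hfix
      · rw [← hMdeg, ← hQdeg]
        have hQm := hQmonic hMmonic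
        exact Polynomial.degree_sub_lt_left hQdeg hQm.ne_zero
          (hQm.leadingCoeff.trans hMmonic.leadingCoeff.symm)
    rw [hc] at hMW hMne
    have h := W.smul_mem (⟨ratC k c, ratC_mem_diffSubfield c⟩ : diffSubfield k Ψ)⁻¹ hMW
    have hone : (⟨ratC k c, ratC_mem_diffSubfield c⟩ : diffSubfield k Ψ)⁻¹ • ratC k c =
        (1 : FractionRing (MvPolynomial Ψ k)) := inv_mul_cancel₀ hMne
    rwa [hone] at h
  refine ⟨hpoly, hcontains, fun W hW hstable hne hsimple => ?_⟩
  refine ((hsimple _ (hcontains W hW hstable hne) fun g v hv => ?_).resolve_left ?_).symm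
  · obtain ⟨c, rfl⟩ := Submodule.mem_span_singleton.1 hv
    refine Submodule.mem_span_singleton.2
      ⟨⟨act g c, map_mem_diffSubfield (act g) g (hactX g) (hactC g) c.2⟩, ?_⟩
    rw [Subfield.smul_def, Subfield.smul_def, smul_eq_mul, smul_eq_mul, mul_one, mul_one]
  · rw [Submodule.span_singleton_eq_bot]
    exact one_ne_zero
end

section
/- Let Ψ be an infinite set, A an associative unital left-noetherian ring equipped with an arbitrary action of S_Ψ by ring automorphisms, and s ∈ ℕ. Let A⟨Ψ^s⟩ denote the free left A-module of finitely supported functions Ψ^s → A, with S_Ψ acting by g•(a·[w]) = (g•a)·[g∘w] (g applied to each coordinate of the s-tuple w). Then for every finite subset S ⊆ Ψ, every S_{Ψ|S}-stable A-submodule M of A⟨Ψ^s⟩ is generated by finitely many S_{Ψ|S}-orbits: there is a finite subset F ⊆ M such that M equals the A-linear span of {g•f : g ∈ S_{Ψ|S}, f ∈ F}. -/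
/-- The twisted action of a permutation `g` of `Ψ` on the free left `A`-module
`A⟨Ψ^s⟩` of finitely supported functions `Ψ^s → A`: it sends `a·[w]` to
`(φ g a)·[g ∘ w]`, where `φ` is the action of `S_Ψ` on `A`. -/
noncomputable def freeTupleAct {Ψ : Type} {A : Type} [Ring A] {s : ℕ}
    (φ : Equiv.Perm Ψ →* (A ≃+* A)) (g : Equiv.Perm Ψ)
    (v : (Fin s → Ψ) →₀ A) : (Fin s → Ψ) →₀ A :=
  Finsupp.mapDomain (fun w => (g : Ψ → Ψ) ∘ w) (v.mapRange (φ g) (map_zero _))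

section TwistedAction

variable {Ψ A : Type} [Ring A] {s : ℕ} (φ : Equiv.Perm Ψ →* (A ≃+* A))

theorem freeTupleAct_apply_comp (g : Equiv.Perm Ψ) (v : (Fin s → Ψ) →₀ A) (w : Fin s → Ψ) :
    freeTupleAct φ g v (g ∘ w) = φ g (v w) := by
  unfold freeTupleAct
  rw [Finsupp.mapDomain_apply (f := fun w : Fin s → Ψ => (g : Ψ → Ψ) ∘ w)
    g.injective.comp_left, Finsupp.mapRange_apply]

theorem freeTupleAct_apply (g : Equiv.Perm Ψ) (v : (Fin s → Ψ) →₀ A) (u : Fin s → Ψ) :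
    freeTupleAct φ g v u = φ g (v (⇑g⁻¹ ∘ u)) := by
  rw [← freeTupleAct_apply_comp]
  congr 1
  ext i
  simp

theorem freeTupleAct_zero (g : Equiv.Perm Ψ) :
    freeTupleAct φ g (0 : (Fin s → Ψ) →₀ A) = 0 := by
  ext u
  simp [freeTupleAct_apply]

theorem freeTupleAct_add (g : Equiv.Perm Ψ) (v w : (Fin s → Ψ) →₀ A) :
    freeTupleAct φ g (v + w) = freeTupleAct φ g v + freeTupleAct φ g w := by
  ext u
  simp [freeTupleAct_apply]

theorem freeTupleAct_smul (g : Equiv.Perm Ψ) (a : A) (v : (Fin s → Ψ) →₀ A) :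
    freeTupleAct φ g (a • v) = φ g a • freeTupleAct φ g v := by
  ext u
  simp [freeTupleAct_apply]

theorem freeTupleAct_one (v : (Fin s → Ψ) →₀ A) : freeTupleAct φ 1 v = v := by
  ext u
  simp [freeTupleAct_apply]

theorem freeTupleAct_mul (g h : Equiv.Perm Ψ) (v : (Fin s → Ψ) →₀ A) :
    freeTupleAct φ (g * h) v = freeTupleAct φ g (freeTupleAct φ h v) := by
  ext u
  simp [freeTupleAct_apply, Function.comp_def]

/-- The `A`-span of the orbits of `F` under the pointwise stabilizer of `S`. -/
noncomputable def orbitSpan (S : Finset Ψ) (F : Set ((Fin s → Ψ) →₀ A)) : Submodule A ((Fin s → Ψ) →₀ A) :=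
  Submodule.span A {m | ∃ (g : Equiv.Perm Ψ) (f : (Fin s → Ψ) →₀ A),
    (∀ t ∈ S, g t = t) ∧ f ∈ F ∧ m = freeTupleAct φ g f}

variable {φ}

theorem freeTupleAct_mem_orbitSpan_of_mem {S : Finset Ψ} {F : Set ((Fin s → Ψ) →₀ A)}
    {g : Equiv.Perm Ψ} (hg : ∀ t ∈ S, g t = t) {f : (Fin s → Ψ) →₀ A} (hf : f ∈ F) :
    freeTupleAct φ g f ∈ orbitSpan φ S F :=
  Submodule.subset_span ⟨g, f, hg, hf, rfl⟩

theorem freeTupleAct_mem_orbitSpan {S : Finset Ψ} {F : Set ((Fin s → Ψ) →₀ A)}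
    {g : Equiv.Perm Ψ} (hg : ∀ t ∈ S, g t = t) {v : (Fin s → Ψ) →₀ A}
    (hv : v ∈ orbitSpan φ S F) : freeTupleAct φ g v ∈ orbitSpan φ S F := by
  unfold orbitSpan at hv
  induction hv using Submodule.span_induction with
  | mem x hx =>
    obtain ⟨h, f, hh, hf, rfl⟩ := hx
    rw [← freeTupleAct_mul]
    exact freeTupleAct_mem_orbitSpan_of_mem (fun t ht => by simp [hh t ht, hg t ht]) hf
  | zero => simp [freeTupleAct_zero]
  | add x y _ _ hx hy => simpa [freeTupleAct_add] using add_mem hx hy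
  | smul a x _ hx => simpa [freeTupleAct_smul] using Submodule.smul_mem _ _ hx

theorem orbitSpan_le {S : Finset Ψ} {F : Set ((Fin s → Ψ) →₀ A)}
    {M : Submodule A ((Fin s → Ψ) →₀ A)}
    (hM : ∀ g : Equiv.Perm Ψ, (∀ t ∈ S, g t = t) → ∀ v ∈ M, freeTupleAct φ g v ∈ M)
    (hF : F ⊆ M) : orbitSpan φ S F ≤ M := by
  refine Submodule.span_le.2 ?_
  rintro _ ⟨g, f, hg, hf, rfl⟩
  exact hM g hg f (hF hf)

end TwistedAction

section Embeddings

/-- A finite subset of an infinite type lies in a sequence of distinct points with infinite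
complement. -/
theorem exists_nat_injective_infinite_compl_range {Ψ : Type} [Infinite Ψ] (S : Finset Ψ) :
    ∃ e : ℕ → Ψ, Function.Injective e ∧ (↑S ⊆ Set.range e) ∧ (Set.range e)ᶜ.Infinite := by
  have : Infinite ↥((S : Set Ψ)ᶜ) := S.finite_toSet.infinite_compl.to_subtype
  let j := Infinite.natEmbedding ↥((S : Set Ψ)ᶜ)
  let p : S ⊕ ℕ → Ψ := Sum.elim (fun t => t) (fun n => j (2 * n))
  have hp : Function.Injective p := by
    refine Subtype.val_injective.sumElim (fun a b h => ?_) (fun a b h => ?_)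
    · have := j.injective (Subtype.ext h)
      omega
    · exact (j (2 * b)).2 (h ▸ a.2)
  obtain ⟨c⟩ := nonempty_equiv_of_countable (α := ℕ) (β := S ⊕ ℕ)
  refine ⟨p ∘ c, hp.comp c.injective, fun t ht => ⟨c.symm (Sum.inl ⟨t, ht⟩), by simp [p]⟩, ?_⟩
  rw [c.surjective.range_comp]
  have hodd : Function.Injective fun n : ℕ => (j (2 * n + 1) : Ψ) := fun a b h => by
    have := j.injective (Subtype.ext h)
    omega
  refine (Set.infinite_range_of_injective hodd).mono ?_
  rintro _ ⟨n, rfl⟩ ⟨t | m, h⟩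
  · have h' : (t : Ψ) = j (2 * n + 1) := h
    exact (j (2 * n + 1)).2 (h' ▸ t.2)
  · have := j.injective (Subtype.ext h)
    omega

theorem exists_perm_apply_eq_of_infinite_compl_range {Ψ : Type} {e e' : ℕ → Ψ}
    (he : Function.Injective e) (he' : Function.Injective e')
    (hc : (Set.range e)ᶜ.Infinite) (hc' : (Set.range e')ᶜ.Infinite) :
    ∃ g : Equiv.Perm Ψ, ∀ n, g (e n) = e' n := by
  classical
  have key : ∀ f : ℕ → Ψ, (Set.range f)ᶜ.Infinite →
      Cardinal.mk ↥((Set.range f)ᶜ) = Cardinal.mk Ψ := fun f hf => by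
    have := hf.to_subtype
    rw [← Cardinal.mk_sum_compl (Set.range f)]
    refine (Cardinal.add_eq_right (Cardinal.aleph0_le_mk _) ?_).symm
    exact (Cardinal.le_aleph0_iff_set_countable.2 (Set.countable_range f)).trans
      (Cardinal.aleph0_le_mk _)
  obtain ⟨c⟩ := Cardinal.eq.1 ((key e hc).trans (key e' hc').symm)
  let r := (Equiv.ofInjective e he).symm.trans (Equiv.ofInjective e' he')
  refine ⟨(Equiv.Set.sumCompl (Set.range e)).symm.trans
    ((Equiv.sumCongr r c).trans (Equiv.Set.sumCompl (Set.range e'))), fun n => ?_⟩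
  have h : (Equiv.ofInjective e he).symm ⟨e n, n, rfl⟩ = n :=
    (Equiv.symm_apply_eq _).2 rfl
  simp [Equiv.Set.sumCompl_symm_apply_of_mem (Set.mem_range_self n), r, h]

theorem exists_perm_fixing_forall_mem_of_infinite {Ψ : Type} {R : Set Ψ} (hR : R.Infinite)
    {S : Finset Ψ} (hS : ↑S ⊆ R) (T : Finset Ψ) :
    ∃ g : Equiv.Perm Ψ, (∀ t ∈ S, g t = t) ∧ ∀ t ∈ T, g t ∈ R := by
  classical
  induction T using Finset.induction_on with
  | empty => exact ⟨1, by simp⟩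
  | insert x T _ ih =>
    obtain ⟨g, hgS, hgT⟩ := ih
    by_cases hx : g x ∈ R
    · exact ⟨g, hgS, by simpa [hx] using hgT⟩
    obtain ⟨y, hyR, hy⟩ := hR.exists_notMem_finset (S ∪ T.image g)
    simp only [Finset.mem_union, Finset.mem_image, not_or, not_exists, not_and] at hy
    refine ⟨Equiv.swap (g x) y * g, fun t ht => ?_, fun t ht => ?_⟩
    · rw [Equiv.Perm.mul_apply, hgS t ht]
      exact Equiv.swap_apply_of_ne_of_ne (fun h => hx (h ▸ hS ht)) (fun h => hy.1 (h ▸ ht))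
    · rw [Equiv.Perm.mul_apply]
      rcases Finset.mem_insert.1 ht with rfl | ht
      · simpa using hyR
      · rw [Equiv.swap_apply_of_ne_of_ne (fun h => hx (by rw [← h]; exact hgT t ht)) (hy.2 t ht)]
        exact hgT t ht

end Embeddings

section Words

/-- `gapCode w` records the values of `w` and the gaps between them. If `gapCode w ≤ gapCode w'`
then a strictly monotone self-map of `ℕ` carries `w` to `w'`. -/
def gapCode {ι : Type} (w : ι → ℕ) : (ι → ℕ) × (ι → ι → ℕ) :=
  (w, fun p q => if w p ≤ w q then w q - w p + 1 else 0)

theorem exists_strictMono_comp_eq_of_gapCode_le {ι : Type} [Fintype ι] {w w' : ι → ℕ}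
    (h : gapCode w ≤ gapCode w') : ∃ ε : ℕ → ℕ, StrictMono ε ∧ ∀ p, ε (w p) = w' p := by
  have hle : ∀ p, w p ≤ w' p := h.1
  have hgap : ∀ p q, w p ≤ w q → w' p - w p ≤ w' q - w q := fun p q hpq => by
    have h1 := h.2 p q
    simp only [gapCode, hpq, if_true] at h1
    have := hle p
    have := hle q
    split_ifs at h1 <;> omega
  refine ⟨fun x => x + (Finset.univ.filter fun p => w p ≤ x).sup fun p => w' p - w p,
    fun x y hxy => add_lt_add_of_lt_of_le hxy (Finset.sup_mono fun p => ?_), fun p => ?_⟩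
  · simpa using fun hp => hp.trans hxy.le
  · have : ((Finset.univ.filter fun q => w q ≤ w p).sup fun q => w' q - w q) = w' p - w p :=
      le_antisymm (Finset.sup_le fun q hq => hgap q p (by simpa using hq))
        (Finset.le_sup (f := fun q => w' q - w q) (by simp))
    have := hle p
    dsimp only
    omega

theorem toLex_comp_le_toLex_comp {s : ℕ} {ε : ℕ → ℕ} (hε : StrictMono ε) {v w : Fin s → ℕ}
    (h : toLex v ≤ toLex w) : toLex (ε ∘ v) ≤ toLex (ε ∘ w) := by
  rcases h.eq_or_lt with h | ⟨i, hi, hlt⟩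
  · rw [toLex.injective h]
  · exact le_of_lt ⟨i, fun j hj => congrArg ε (hi j hj), hε hlt⟩

end Words

section LeadingWords

variable {Ψ A : Type} [Ring A] {s : ℕ}

/-- Every word in the support of `f` has the form `e ∘ v` with `v` lexicographically at most `w`. -/
def SupportLexLE (e : ℕ → Ψ) (f : (Fin s → Ψ) →₀ A) (w : Fin s → ℕ) : Prop :=
  ∀ u, f u ≠ 0 → ∃ v, u = e ∘ v ∧ toLex v ≤ toLex w

theorem exists_supportLexLE {e : ℕ → Ψ} {f : (Fin s → Ψ) →₀ A} (hf : f ≠ 0)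
    (h : ∀ u, f u ≠ 0 → ∃ v, u = e ∘ v) : ∃ w, f (e ∘ w) ≠ 0 ∧ SupportLexLE e f w := by
  choose! r hr using h
  obtain ⟨u, hu, hmax⟩ := f.support.exists_max_image (fun u => toLex (r u))
    (Finsupp.support_nonempty_iff.2 hf)
  rw [Finsupp.mem_support_iff] at hu
  exact ⟨r u, hr u hu ▸ hu, fun x hx => ⟨r x, hr x hx, hmax x (Finsupp.mem_support_iff.2 hx)⟩⟩

theorem SupportLexLE.zero (e : ℕ → Ψ) (w : Fin s → ℕ) :
    SupportLexLE e (0 : (Fin s → Ψ) →₀ A) w := fun _ h => absurd rfl h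

theorem SupportLexLE.add {e : ℕ → Ψ} {f g : (Fin s → Ψ) →₀ A} {w : Fin s → ℕ}
    (hf : SupportLexLE e f w) (hg : SupportLexLE e g w) : SupportLexLE e (f + g) w := by
  intro u hu
  by_cases h : f u = 0
  · exact hg u fun h' => hu (by simp [h, h'])
  · exact hf u h

theorem SupportLexLE.smul {e : ℕ → Ψ} {f : (Fin s → Ψ) →₀ A} {w : Fin s → ℕ}
    (hf : SupportLexLE e f w) (a : A) : SupportLexLE e (a • f) w :=
  fun u hu => hf u fun h => hu (by simp [h])

theorem SupportLexLE.freeTupleAct (φ : Equiv.Perm Ψ →* (A ≃+* A)) {e : ℕ → Ψ}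
    {f : (Fin s → Ψ) →₀ A} {w : Fin s → ℕ} (hf : SupportLexLE e f w) {g : Equiv.Perm Ψ}
    {ε : ℕ → ℕ} (hε : StrictMono ε) (hg : ∀ n, g (e n) = e (ε n)) :
    SupportLexLE e (freeTupleAct φ g f) (ε ∘ w) := by
  intro u hu
  rw [freeTupleAct_apply] at hu
  obtain ⟨v, hv, hvw⟩ := hf (⇑g⁻¹ ∘ u) fun h => hu (by rw [h, map_zero])
  refine ⟨ε ∘ v, funext fun i => ?_, toLex_comp_le_toLex_comp hε hvw⟩
  have := congrFun hv i
  simp only [Function.comp_apply] at this ⊢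
  rw [← hg, ← this]
  simp

/-- A submodule not contained in a second one has an element outside of it whose leading word is
minimal. -/
theorem exists_minimal_supportLexLE {e : ℕ → Ψ} (he : Function.Injective e)
    {M N : Submodule A ((Fin s → Ψ) →₀ A)}
    {f : (Fin s → Ψ) →₀ A} (hfM : f ∈ M) (hfN : f ∉ N) (hf : ∀ u, f u ≠ 0 → ∃ v, u = e ∘ v) :
    ∃ f ∈ M, ∃ w, f ∉ N ∧ SupportLexLE e f w ∧
      ∀ f' ∈ M, SupportLexLE e f' w → f' (e ∘ w) = 0 → f' ∈ N := by
  obtain ⟨w₀, -, hw₀⟩ := exists_supportLexLE (e := e) (f := f) (fun h => hfN (h ▸ N.zero_mem)) hf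
  obtain ⟨w, ⟨f₁, hM₁, hN₁, hw₁⟩, hmin⟩ := (wellFounded_lt (α := Lex (Fin s → ℕ))).has_min
    {w | ∃ f ∈ M, f ∉ N ∧ SupportLexLE e f (ofLex w)} ⟨toLex w₀, f, hfM, hfN, hw₀⟩
  refine ⟨f₁, hM₁, ofLex w, hN₁, hw₁, fun f' hM' hw' h0 => ?_⟩
  by_contra hN'
  obtain ⟨w', hne, hle⟩ := exists_supportLexLE (e := e) (f := f')
    (fun h => hN' (h ▸ N.zero_mem)) fun u hu => (hw' u hu).imp fun _ => And.left
  obtain ⟨v, hv, hvw⟩ := hw' _ hne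
  obtain rfl := he.comp_left hv
  exact hmin (toLex w') ⟨f', hM', hN', hle⟩
    (lt_of_le_of_ne hvw fun h => hne (by rwa [← h] at h0))

end LeadingWords

section Sequences

variable {Ψ A : Type} [Ring A] {s : ℕ}

/-- The permutation `g` fixes `S` pointwise, restricts to a strictly monotone map on the sequence
`e`, and carries the word `w` to `w'`. -/
def IsMonotoneShift (S : Finset Ψ) (e : ℕ → Ψ) (g : Equiv.Perm Ψ) (w w' : Fin s → ℕ) : Prop :=
  (∀ t ∈ S, g t = t) ∧ ∃ ε : ℕ → ℕ, StrictMono ε ∧ (∀ n, g (e n) = e (ε n)) ∧ ε ∘ w = w'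

theorem IsMonotoneShift.one (S : Finset Ψ) (e : ℕ → Ψ) (w : Fin s → ℕ) :
    IsMonotoneShift S e 1 w w :=
  ⟨fun _ _ => rfl, id, strictMono_id, fun _ => rfl, rfl⟩

theorem IsMonotoneShift.mul {S : Finset Ψ} {e : ℕ → Ψ} {g h : Equiv.Perm Ψ}
    {w w' w'' : Fin s → ℕ} (hg : IsMonotoneShift S e g w' w'')
    (hh : IsMonotoneShift S e h w w') : IsMonotoneShift S e (g * h) w w'' := by
  obtain ⟨hgS, ε, hε, hgε, rfl⟩ := hg
  obtain ⟨hhS, δ, hδ, hhδ, rfl⟩ := hh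
  exact ⟨fun t ht => by simp [hhS t ht, hgS t ht], ε ∘ δ, hε.comp hδ,
    fun n => by simp [hhδ, hgε], rfl⟩

theorem exists_subseq_isMonotoneShift {S : Finset Ψ} {e : ℕ → Ψ} (he : Function.Injective e)
    (hS : ↑S ⊆ Set.range e) (hc : (Set.range e)ᶜ.Infinite) (w : ℕ → Fin s → ℕ) :
    ∃ r : ℕ → ℕ, StrictMono r ∧
      ∀ i, ∃ g : Equiv.Perm Ψ, IsMonotoneShift S e g (w (r i)) (w (r (i + 1))) := by
  choose k hk using fun t : S => hS t.2
  let x : ℕ → Fin s ⊕ S → ℕ := fun n => Sum.elim (w n) k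
  obtain ⟨r, hr⟩ := wellQuasiOrdered_le.exists_monotone_subseq fun n => gapCode (x n)
  refine ⟨r, r.strictMono, fun i => ?_⟩
  obtain ⟨ε, hε, hεx⟩ := exists_strictMono_comp_eq_of_gapCode_le (hr i (i + 1) i.le_succ)
  obtain ⟨g, hg⟩ := exists_perm_apply_eq_of_infinite_compl_range he (he.comp hε.injective) hc
    (hc.mono (Set.compl_subset_compl.2 (Set.range_comp_subset_range ε e)))
  refine ⟨g, fun t ht => ?_, ε, hε, hg, funext fun p => hεx (Sum.inl p)⟩
  have hfix : ε (k ⟨t, ht⟩) = k ⟨t, ht⟩ := hεx (Sum.inr ⟨t, ht⟩)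
  have := hg (k ⟨t, ht⟩)
  rwa [Function.comp_apply, hfix, hk] at this

theorem exists_coherent_isMonotoneShift {S : Finset Ψ} {e : ℕ → Ψ} {w : ℕ → Fin s → ℕ}
    (h : ∀ i, ∃ g : Equiv.Perm Ψ, IsMonotoneShift S e g (w i) (w (i + 1))) :
    ∃ G : ℕ → Equiv.Perm Ψ, ∀ l m, l ≤ m → IsMonotoneShift S e (G m * (G l)⁻¹) (w l) (w m) := by
  choose g hg using h
  let G : ℕ → Equiv.Perm Ψ := fun n => Nat.rec 1 (fun i x => g i * x) n
  refine ⟨G, fun l m hlm => ?_⟩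
  induction m, hlm using Nat.le_induction with
  | base => simpa using IsMonotoneShift.one S e (w l)
  | succ m _ ih => exact mul_assoc (g m) (G m) (G l)⁻¹ ▸ (hg m).mul ih

theorem exists_seq_of_forall_finset_subset {α : Type} {M : Set α} {P : Finset α → α → Prop}
    (h : ∀ F : Finset α, ↑F ⊆ M → ∃ f ∈ M, P F f) :
    ∃ (f : ℕ → α) (F : ℕ → Finset α), (∀ n, f n ∈ M) ∧ (∀ n, ↑(F n) ⊆ M) ∧
      (∀ n, P (F n) (f n)) ∧ ∀ l m, l < m → f l ∈ F m := by
  classical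
  choose next hM hP using h
  let F : ℕ → {F : Finset α // ↑F ⊆ M} := fun n => Nat.rec ⟨∅, by simp⟩
    (fun _ x => ⟨insert (next x.1 x.2) x.1, by
      simpa [Set.insert_subset_iff] using ⟨hM x.1 x.2, x.2⟩⟩) n
  refine ⟨fun n => next (F n).1 (F n).2, fun n => (F n).1, fun n => hM _ _, fun n => (F n).2,
    fun n => hP _ _, fun l m hlm => ?_⟩
  induction m, hlm using Nat.le_induction with
  | base => exact Finset.mem_insert_self _ _
  | succ m _ ih => exact Finset.mem_insert_of_mem ih

theorem exists_mem_span_image_Iio [IsNoetherianRing A] (b : ℕ → A) :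
    ∃ m, b m ∈ Submodule.span A (b '' Set.Iio m) := by
  obtain ⟨n, hn⟩ := monotone_stabilizes_iff_noetherian.2 (inferInstance : IsNoetherian A A)
    ⟨fun n => Submodule.span A (b '' Set.Iio n),
      fun _ _ h => Submodule.span_mono (Set.image_mono (Set.Iio_subset_Iio h))⟩
  refine ⟨n, ?_⟩
  have h : Submodule.span A (b '' Set.Iio n) = Submodule.span A (b '' Set.Iio (n + 1)) :=
    hn (n + 1) n.le_succ
  rw [h]
  exact Submodule.subset_span ⟨n, n.lt_succ_self, rfl⟩

end Sequences

/-- A stable submodule larger than the span of the orbits of `F` has an element outside that span,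
supported on words in `e`, whose leading word is minimal. -/
theorem exists_minimal_not_mem_orbitSpan {Ψ A : Type} [Ring A] {s : ℕ}
    {φ : Equiv.Perm Ψ →* (A ≃+* A)} {S : Finset Ψ} {e : ℕ → Ψ} (he : Function.Injective e)
    (hS : ↑S ⊆ Set.range e) {M : Submodule A ((Fin s → Ψ) →₀ A)}
    (hM : ∀ g : Equiv.Perm Ψ, (∀ t ∈ S, g t = t) → ∀ v ∈ M, freeTupleAct φ g v ∈ M)
    {F : Set ((Fin s → Ψ) →₀ A)} (hF : ¬ M ≤ orbitSpan φ S F) :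
    ∃ f ∈ M, ∃ w, f ∉ orbitSpan φ S F ∧ SupportLexLE e f w ∧
      ∀ f' ∈ M, SupportLexLE e f' w → f' (e ∘ w) = 0 → f' ∈ orbitSpan φ S F := by
  classical
  obtain ⟨f, hfM, hfN⟩ := SetLike.not_le_iff_exists.1 hF
  obtain ⟨g, hgS, hg⟩ := exists_perm_fixing_forall_mem_of_infinite
    (Set.infinite_range_of_injective he) hS (f.support.biUnion fun u => Finset.univ.image u)
  refine exists_minimal_supportLexLE he (hM g hgS f hfM) (fun h => hfN ?_) fun u hu => ?_
  · have := freeTupleAct_mem_orbitSpan (g := g⁻¹)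
      (fun t ht => Equiv.Perm.inv_eq_iff_eq.2 (hgS t ht).symm) h
    rwa [← freeTupleAct_mul, inv_mul_cancel, freeTupleAct_one] at this
  · rw [freeTupleAct_apply] at hu
    have hne : f (⇑g⁻¹ ∘ u) ≠ 0 := fun h => hu (by rw [h, map_zero])
    have hmem : ∀ i, u i ∈ Set.range e := fun i => by
      simpa using hg (g⁻¹ (u i)) (Finset.mem_biUnion.2
        ⟨_, Finsupp.mem_support_iff.2 hne, Finset.mem_image.2 ⟨i, Finset.mem_univ i, rfl⟩⟩)
    choose v hv using hmem
    exact ⟨v, funext fun i => (hv i).symm⟩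

/-- **The free module `A⟨Ψ^s⟩` is noetherian as a smooth semilinear module over
every pointwise stabilizer.**  `A` is a left noetherian ring with an arbitrary
action `φ` of `S_Ψ` by ring automorphisms, and `A⟨Ψ^s⟩` carries the twisted
action `g • (a·[w]) = (φ g a)·[g ∘ w]`.  Then for every finite `S ⊆ Ψ`, every
`S_{Ψ|S}`-stable `A`-submodule `M` of `A⟨Ψ^s⟩` is the `A`-linear span of
finitely many `S_{Ψ|S}`-orbits. -/
theorem free_tuple_module_noetherian_over_pointwise_stabilizer
    (Ψ : Type) [Infinite Ψ]
    (A : Type) [Ring A] [IsNoetherianRing A]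
    (φ : Equiv.Perm Ψ →* (A ≃+* A)) (s : ℕ) :
    ∀ (S : Finset Ψ) (M : Submodule A ((Fin s → Ψ) →₀ A)),
      (∀ g : Equiv.Perm Ψ, (∀ t ∈ S, g t = t) → ∀ v ∈ M, freeTupleAct φ g v ∈ M) →
      ∃ F : Finset ((Fin s → Ψ) →₀ A), (F : Set ((Fin s → Ψ) →₀ A)) ⊆ M ∧
        M = Submodule.span A
          {m : (Fin s → Ψ) →₀ A | ∃ (g : Equiv.Perm Ψ) (f : (Fin s → Ψ) →₀ A),
            (∀ t ∈ S, g t = t) ∧ f ∈ F ∧ m = freeTupleAct φ g f} := by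
  intro S M hM
  obtain ⟨e, he, hS, hc⟩ := exists_nat_injective_infinite_compl_range S
  by_contra! H
  have hnot : ∀ F : Finset ((Fin s → Ψ) →₀ A), (F : Set ((Fin s → Ψ) →₀ A)) ⊆ M →
      ¬ M ≤ orbitSpan φ S F := fun F hF hle =>
    H F hF (le_antisymm hle (orbitSpan_le hM hF))
  obtain ⟨f, F, hfM, hFM, hP, hlt⟩ := exists_seq_of_forall_finset_subset
    (M := (M : Set ((Fin s → Ψ) →₀ A)))
    fun F hF => exists_minimal_not_mem_orbitSpan he hS hM (hnot F hF)
  choose w hN hw hmin using hP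
  obtain ⟨r, hr, hshift⟩ := exists_subseq_isMonotoneShift he hS hc w
  obtain ⟨G, hG⟩ := exists_coherent_isMonotoneShift (w := w ∘ r) hshift
  obtain ⟨m, hm⟩ := exists_mem_span_image_Iio
    fun l => φ (G l)⁻¹ (f (r l) (e ∘ w (r l)))
  -- Every element of the ideal spanned by the earlier pulled-back leading coefficients is,
  -- after transport by `G m`, a leading coefficient of the span of the earlier orbits.
  have lift : ∀ x ∈ Submodule.span A
      ((fun l => φ (G l)⁻¹ (f (r l) (e ∘ w (r l)))) '' Set.Iio m),
      ∃ h ∈ orbitSpan φ S (F (r m)), SupportLexLE e h (w (r m)) ∧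
        h (e ∘ w (r m)) = φ (G m) x := by
    intro x hx
    induction hx using Submodule.span_induction with
    | mem x hx =>
      obtain ⟨l, hl, rfl⟩ := hx
      obtain ⟨hgS, ε, hε, hgε, hεw⟩ := hG l m (le_of_lt hl)
      simp only [Function.comp_apply] at hεw
      refine ⟨freeTupleAct φ (G m * (G l)⁻¹) (f (r l)),
        freeTupleAct_mem_orbitSpan_of_mem hgS (hlt _ _ (hr hl)),
        hεw ▸ (hw (r l)).freeTupleAct φ hε hgε, ?_⟩
      have : e ∘ w (r m) = ⇑(G m * (G l)⁻¹) ∘ (e ∘ w (r l)) := by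
        rw [← hεw]
        exact funext fun i => (hgε _).symm
      rw [this, freeTupleAct_apply_comp, map_mul, RingAut.mul_apply]
    | zero => exact ⟨0, zero_mem _, SupportLexLE.zero _ _, by simp⟩
    | add x y _ _ hx hy =>
      obtain ⟨h, hh, hhw, hhx⟩ := hx
      obtain ⟨k, hk, hkw, hky⟩ := hy
      exact ⟨h + k, add_mem hh hk, hhw.add hkw, by simp [hhx, hky]⟩
    | smul a x _ hx =>
      obtain ⟨h, hh, hhw, hhx⟩ := hx
      exact ⟨φ (G m) a • h, Submodule.smul_mem _ _ hh, hhw.smul _, by simp [hhx]⟩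
  obtain ⟨h, hh, hhw, hhc⟩ := lift _ hm
  have hsub : f (r m) + (-1 : A) • h ∈ orbitSpan φ S (F (r m)) := by
    refine hmin (r m) _ (M.add_mem (hfM _) (M.smul_mem _ (orbitSpan_le hM (hFM _) hh)))
      ((hw _).add (hhw.smul _)) ?_
    rw [Finsupp.add_apply, Finsupp.smul_apply, hhc, ← RingAut.mul_apply, ← map_mul,
      mul_inv_cancel, map_one, RingAut.one_apply, neg_one_smul, add_neg_cancel]
  refine hN (r m) ?_
  simpa using add_mem hsub hh
end
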